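/- Proposition 2 (finite-horizon form): For u, v ≥ 0 define Î_N(u,v) := sup over sources in 𝒫(u,u) of Σ_{t=1}^N I(X^t, S_0^{t-v-1}; Y_t | Y^{t-1}) (the state block S_0^{t-v-1} is omitted when t − v − 1 < 0), where the informations are computed under the joint law induced by the source. Then: (1) Î_N(u+1,v+1) ≤ Î_N(u+1,v) ≤ Î_N(u,v) and Î_N(u+1,v+1) ≤ Î_N(u,v+1) ≤ Î_N(u,v); (2) for every source in 𝒫(u,u) and every v ≥ 0, the directed information satisfies I(X^N → Y^N) ≤ Σ_{t=1}^N I(X^t, S_0^{t-v-1}; Y_t | Y^{t-1}), and the right-hand side is nonincreasing in v. -/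

import Mathlib

/-!
Common framework: finite-state channels (FSCs), non-controllable FSCs,
sources with delayed feedback (FB) and delayed state information (SI),
induced joint pmfs, conditional probabilities and conditional mutual
information, following Huang–Kavčić–Ma, "Upper Bounds on the Capacities of
Non-Controllable Finite-State Channels with/without Feedback".

Time convention: for a horizon `N`, the channel inputs are `X_1,…,X_N`
(coordinate `x i` of `x : Fin N → X` is `X_{i+1}`), the states are
`S_0,…,S_N` (coordinate `s j` of `s : Fin (N+1) → S` is `S_j`), and the
outputs are `Y_1,…,Y_N` (coordinate `y i` is `Y_{i+1}`).
-/

open Finset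

noncomputable section

namespace FSCPaper

/-- Probability of an event under a pmf `p` on a finite sample space. -/
def prE {Ω : Type} [Fintype Ω] (p : Ω → ℝ) (E : Set Ω) : ℝ :=
  ∑ ω : Ω, E.indicator p ω

/-- Conditional probability `Pr(E | F)`, a ratio of (sums of) marginals
(with the `0/0 = 0` junk-value convention of real division). -/
def condPr {Ω : Type} [Fintype Ω] (p : Ω → ℝ) (E F : Set Ω) : ℝ :=
  prE p (E ∩ F) / prE p F

/-- The conditional pmf `Pr(· | F)` given an event `F`. -/
def condPMF {Ω : Type} [Fintype Ω] (p : Ω → ℝ) (F : Set Ω) : Ω → ℝ :=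
  fun ω => F.indicator p ω / prE p F

/-- Conditional mutual information `I(A;B|C)` of finite-valued random
variables `fA, fB, fC` under the pmf `p`; zero-probability terms
contribute `0` (the factor in front of the logarithm vanishes). -/
def condMI {Ω A B C : Type} [Fintype Ω] [Fintype A] [Fintype B] [Fintype C]
    (p : Ω → ℝ) (fA : Ω → A) (fB : Ω → B) (fC : Ω → C) : ℝ :=
  ∑ a : A, ∑ b : B, ∑ c : C,
    prE p {ω | fA ω = a ∧ fB ω = b ∧ fC ω = c} *
      Real.log (condPr p {ω | fA ω = a ∧ fB ω = b} {ω | fC ω = c} /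
        (condPr p {ω | fA ω = a} {ω | fC ω = c} *
          condPr p {ω | fB ω = b} {ω | fC ω = c}))

/-- Trajectories `(x_1^N, s_0^N, y_1^N)`. -/
abbrev Traj (X S Y : Type) (N : ℕ) : Type :=
  (Fin N → X) × (Fin (N + 1) → S) × (Fin N → Y)

/-- A general finite-state channel: channel transition kernel
`W(y, s' | x, s)` (a pmf on `Y × S` for each `(x,s)`) and initial state
pmf `init`. -/
structure FSC (X S Y : Type) [Fintype S] [Fintype Y] : Type where
  W : Y → S → X → S → ℝ
  init : S → ℝ
  W_nonneg : ∀ y s' x s, 0 ≤ W y s' x s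
  W_sum : ∀ x s, (∑ y : Y, ∑ s' : S, W y s' x s) = 1
  init_nonneg : ∀ s, 0 ≤ init s
  init_sum : (∑ s : S, init s) = 1

/-- A source without feedback: conditional pmfs `π_t(x_t | x^{t-1})`;
`pol t x a` is the probability that `X_{t+1} = a` given that the previous
inputs are the corresponding coordinates of `x` (by `causal` it depends
only on the coordinates `x j` with `j < t`). -/
structure FFSource (X : Type) [Fintype X] (N : ℕ) : Type where
  pol : Fin N → (Fin N → X) → X → ℝ
  nonneg : ∀ t x a, 0 ≤ pol t x a
  sum_one : ∀ t x, (∑ a : X, pol t x a) = 1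
  causal : ∀ (t : Fin N) (x x' : Fin N → X),
    (∀ j : Fin N, (j : ℕ) < (t : ℕ) → x j = x' j) → pol t x = pol t x'

/-- A non-controllable finite-state channel: output kernel `P(y|x,s)`,
free state-transition kernel `Q(s'|s)`, and initial state pmf `init`. -/
structure NCFSC (X S Y : Type) [Fintype S] [Fintype Y] : Type where
  P : Y → X → S → ℝ
  Q : S → S → ℝ
  init : S → ℝ
  P_nonneg : ∀ y x s, 0 ≤ P y x s
  P_sum : ∀ x s, (∑ y : Y, P y x s) = 1
  Q_nonneg : ∀ s' s, 0 ≤ Q s' s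
  Q_sum : ∀ s, (∑ s' : S, Q s' s) = 1
  init_nonneg : ∀ s, 0 ≤ init s
  init_sum : (∑ s : S, init s) = 1

/-- A source with `u`-delayed feedback and `u`-delayed state information
(the set `𝒫(u,u)`): `pol t x s y a` is
`π_{t+1}(a | x^{t}, s_0^{t-u}, y^{t-u})` in 1-based time; by `causal` it
depends on `(x, s, y)` only through the coordinates
`x_1^{t}` (indices `j < t`), `s_0^{t-u}` (indices `j + u ≤ t`) and
`y_1^{t-u}` (indices `j + u + 1 ≤ t`), i.e. on the past inputs, the
`u`-delayed state information and the `u`-delayed output feedback. -/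
structure Source (X S Y : Type) [Fintype X] [Fintype S] [Fintype Y] (N u : ℕ) : Type where
  pol : Fin N → (Fin N → X) → (Fin (N + 1) → S) → (Fin N → Y) → X → ℝ
  nonneg : ∀ t x s y a, 0 ≤ pol t x s y a
  sum_one : ∀ t x s y, (∑ a : X, pol t x s y a) = 1
  causal : ∀ (t : Fin N) (x x' : Fin N → X) (s s' : Fin (N + 1) → S) (y y' : Fin N → Y),
    (∀ j : Fin N, (j : ℕ) < (t : ℕ) → x j = x' j) →
    (∀ j : Fin (N + 1), (j : ℕ) + u ≤ (t : ℕ) → s j = s' j) →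
    (∀ j : Fin N, (j : ℕ) + u + 1 ≤ (t : ℕ) → y j = y' j) →
    pol t x s y = pol t x' s' y'

variable {X S Y : Type} [Fintype X] [Fintype S] [Fintype Y]

/-- Joint pmf induced by a general FSC and a feedforward source:
`Pr(x^N, s_0^N, y^N) = μ(s_0) ∏_t π_t(x_t|x^{t-1}) W(y_t, s_t | x_t, s_{t-1})`. -/
def jointP0 {N : ℕ} (ch : FSC X S Y) (src : FFSource X N) (ω : Traj X S Y N) : ℝ :=
  ch.init (ω.2.1 0) *
    ∏ i : Fin N,
      src.pol i ω.1 (ω.1 i) *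
        ch.W (ω.2.2 i) (ω.2.1 i.succ) (ω.1 i) (ω.2.1 i.castSucc)

/-- Joint channel transition `W(y, s' | x, s) = P(y|x,s) · Q(s'|s)` of a
non-controllable FSC. -/
def NCFSC.W (ch : NCFSC X S Y) (y : Y) (s' : S) (x : X) (s : S) : ℝ :=
  ch.P y x s * ch.Q s' s

/-- Joint pmf induced by a non-controllable FSC and a source in `𝒫(u,u)`:
`Pr(x^N, s_0^N, y^N) = μ(s_0) ∏_t π_t(x_t|x^{t-1},s_0^{t-u-1},y^{t-u-1}) W(y_t,s_t|x_t,s_{t-1})`. -/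
def jointP {N u : ℕ} (ch : NCFSC X S Y) (src : Source X S Y N u) (ω : Traj X S Y N) : ℝ :=
  ch.init (ω.2.1 0) *
    ∏ i : Fin N,
      src.pol i ω.1 ω.2.1 ω.2.2 (ω.1 i) *
        ch.W (ω.2.2 i) (ω.2.1 i.succ) (ω.1 i) (ω.2.1 i.castSucc)

/-- A source in `𝒫(u,u)` is a `v`-th order conditional Markov source
(the set `𝒫_v(u,u)`) if each policy depends on its arguments only through
`(x_{t-v}^{t-1}, s_{t-v-1}^{t-u-1}, y^{t-u-1})` (windows truncated for
small `t`). -/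
def IsMarkov {N u : ℕ} (v : ℕ) (src : Source X S Y N u) : Prop :=
  ∀ (t : Fin N) (x x' : Fin N → X) (s s' : Fin (N + 1) → S) (y y' : Fin N → Y),
    (∀ j : Fin N, (t : ℕ) ≤ (j : ℕ) + v ∧ (j : ℕ) < (t : ℕ) → x j = x' j) →
    (∀ j : Fin (N + 1), (t : ℕ) ≤ (j : ℕ) + v ∧ (j : ℕ) + u ≤ (t : ℕ) → s j = s' j) →
    (∀ j : Fin N, (j : ℕ) + u + 1 ≤ (t : ℕ) → y j = y' j) →
    src.pol t x s y = src.pol t x' s' y'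

/-- `Σ_{t=1}^N I(X^t, S_0^{t-v-1}; Y_t | Y^{t-1})` under the joint law of
the source (state window omitted/truncated when `t - v - 1 < 0`). -/
def objFull {N u : ℕ} (v : ℕ) (ch : NCFSC X S Y) (src : Source X S Y N u) : ℝ :=
  ∑ t : Fin N,
    condMI (jointP ch src)
      (fun ω : Traj X S Y N =>
        ((fun j : {j : Fin N // (j : ℕ) ≤ (t : ℕ)} => ω.1 j.1),
          fun j : {j : Fin (N + 1) // (j : ℕ) + v ≤ (t : ℕ)} => ω.2.1 j.1))
      (fun ω => ω.2.2 t)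
      (fun ω => fun j : {j : Fin N // (j : ℕ) < (t : ℕ)} => ω.2.2 j.1)

/-- `Σ_{t=1}^N I(X_{t-v}^t, S_{t-v-1}; Y_t | Y^{t-1})` under the joint law
of the source (windows truncated for small `t`; the singleton state window
`S_{t-v-1}` is encoded by the condition `j + v = t - 1` in 0-based time and
is empty for `t ≤ v`). -/
def objWin {N u : ℕ} (v : ℕ) (ch : NCFSC X S Y) (src : Source X S Y N u) : ℝ :=
  ∑ t : Fin N,
    condMI (jointP ch src)
      (fun ω : Traj X S Y N =>
        ((fun j : {j : Fin N // (t : ℕ) ≤ (j : ℕ) + v ∧ (j : ℕ) ≤ (t : ℕ)} => ω.1 j.1),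
          fun j : {j : Fin (N + 1) // (j : ℕ) + v = (t : ℕ)} => ω.2.1 j.1))
      (fun ω => ω.2.2 t)
      (fun ω => fun j : {j : Fin N // (j : ℕ) < (t : ℕ)} => ω.2.2 j.1)

/-- Directed information `I(X^N → Y^N) = Σ_{t=1}^N I(X^t; Y_t | Y^{t-1})`. -/
def directedInfo {N u : ℕ} (ch : NCFSC X S Y) (src : Source X S Y N u) : ℝ :=
  ∑ t : Fin N,
    condMI (jointP ch src)
      (fun ω : Traj X S Y N => fun j : {j : Fin N // (j : ℕ) ≤ (t : ℕ)} => ω.1 j.1)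
      (fun ω => ω.2.2 t)
      (fun ω => fun j : {j : Fin N // (j : ℕ) < (t : ℕ)} => ω.2.2 j.1)

/-- The a posteriori vectors `α_{t-1}(y^{t-u-1})` and `α_{t-1}(ỹ^{t-u-1})`
(at the 1-based time `(t:ℕ)+1`) induced by the two output histories `yh`
and `yh'` coincide: for all window values `(x_{t-v}^{t-1}, s_{t-v-1}^{t-u-1})`
the two a posteriori probabilities agree. -/
def alphaWinEq {N u : ℕ} (v : ℕ) (ch : NCFSC X S Y) (src : Source X S Y N u)
    (t : Fin N) (yh yh' : Fin N → Y) : Prop :=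
  ∀ (xf : Fin N → X) (sf : Fin (N + 1) → S),
    condPr (jointP ch src)
        {ω : Traj X S Y N |
          (∀ j : Fin N, (t : ℕ) ≤ (j : ℕ) + v ∧ (j : ℕ) < (t : ℕ) → ω.1 j = xf j) ∧
            ∀ j : Fin (N + 1), (t : ℕ) ≤ (j : ℕ) + v ∧ (j : ℕ) + u ≤ (t : ℕ) → ω.2.1 j = sf j}
        {ω : Traj X S Y N | ∀ j : Fin N, (j : ℕ) + u + 1 ≤ (t : ℕ) → ω.2.2 j = yh j} =
      condPr (jointP ch src)
        {ω : Traj X S Y N |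
          (∀ j : Fin N, (t : ℕ) ≤ (j : ℕ) + v ∧ (j : ℕ) < (t : ℕ) → ω.1 j = xf j) ∧
            ∀ j : Fin (N + 1), (t : ℕ) ≤ (j : ℕ) + v ∧ (j : ℕ) + u ≤ (t : ℕ) → ω.2.1 j = sf j}
        {ω : Traj X S Y N | ∀ j : Fin N, (j : ℕ) + u + 1 ≤ (t : ℕ) → ω.2.2 j = yh' j}

/-- The set `𝒫'_v(u,u)`: the policy at each time gives the same value on
any two positive-probability output histories inducing the same a
posteriori vector. -/
def AlphaPolicy {N u : ℕ} (v : ℕ) (ch : NCFSC X S Y) (src : Source X S Y N u) : Prop :=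
  ∀ (t : Fin N) (yh yh' : Fin N → Y),
    0 < prE (jointP ch src)
        {ω : Traj X S Y N | ∀ j : Fin N, (j : ℕ) + u + 1 ≤ (t : ℕ) → ω.2.2 j = yh j} →
    0 < prE (jointP ch src)
        {ω : Traj X S Y N | ∀ j : Fin N, (j : ℕ) + u + 1 ≤ (t : ℕ) → ω.2.2 j = yh' j} →
    alphaWinEq v ch src t yh yh' →
    ∀ (xf : Fin N → X) (sf : Fin (N + 1) → S) (a : X),
      src.pol t xf sf yh a = src.pol t xf sf yh' a

section Helpers

open Classical in
theorem prE_eq {Ω : Type} [Fintype Ω] (p : Ω → ℝ) (E : Set Ω) :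
    prE p E = ∑ ω : Ω, if ω ∈ E then p ω else 0 := by
  unfold prE
  refine Finset.sum_congr rfl fun ω _ => ?_
  rw [Set.indicator_apply]

theorem prE_nonneg {Ω : Type} [Fintype Ω] {p : Ω → ℝ} (hp : ∀ ω, 0 ≤ p ω) (E : Set Ω) :
    0 ≤ prE p E :=
  Finset.sum_nonneg fun ω _ => Set.indicator_nonneg (fun ω _ => hp ω) ω

theorem prE_mono {Ω : Type} [Fintype Ω] {p : Ω → ℝ} (hp : ∀ ω, 0 ≤ p ω) {E F : Set Ω}
    (h : E ⊆ F) : prE p E ≤ prE p F :=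
  Finset.sum_le_sum fun ω _ => Set.indicator_le_indicator_of_subset h hp ω

theorem sum_prE_mul {Ω A : Type} [Fintype Ω] [Fintype A] (p : Ω → ℝ) (h : Ω → A)
    (R : Set Ω) (L : A → ℝ) :
    ∑ a : A, prE p {ω | h ω = a ∧ ω ∈ R} * L a = ∑ ω : Ω, R.indicator p ω * L (h ω) := by
  classical
  simp only [prE_eq, Finset.sum_mul, Set.indicator_apply, Set.mem_ofPred_eq]
  rw [Finset.sum_comm]
  refine Finset.sum_congr rfl fun ω _ => ?_
  rw [Finset.sum_eq_single (h ω)]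
  · simp
  · intro b _ hb
    simp [Ne.symm hb]
  · simp

theorem sum_prE {Ω A : Type} [Fintype Ω] [Fintype A] (p : Ω → ℝ) (h : Ω → A)
    (R : Set Ω) : ∑ a : A, prE p {ω | h ω = a ∧ ω ∈ R} = prE p R := by
  have := sum_prE_mul p h R (fun _ => 1)
  simpa [prE] using this

theorem key_term {m M k K pc pbc : ℝ} (hm : 0 ≤ m) (hmM : m ≤ M) (hmk : m ≤ k) (hMK : M ≤ K)
    (hMb : M ≤ pbc) (hbc : pbc ≤ pc) :
    m * Real.log (M / pc / (K / pc * (pbc / pc))) -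
      m * Real.log (m / pc / (k / pc * (pbc / pc))) ≤ M * (k / K) - m := by
  rcases hm.eq_or_lt with h | h
  · subst h
    have : 0 ≤ M * (k / K) := mul_nonneg hmM (div_nonneg hmk (hmM.trans hMK))
    simpa using this
  · have hM : 0 < M := h.trans_le hmM
    have hk : 0 < k := h.trans_le hmk
    have hK : 0 < K := hM.trans_le hMK
    have hb : 0 < pbc := hM.trans_le hMb
    have hc : 0 < pc := hb.trans_le hbc
    rw [← mul_sub, ← Real.log_div (by positivity) (by positivity)]
    have e : M / pc / (K / pc * (pbc / pc)) / (m / pc / (k / pc * (pbc / pc))) =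
        M * (k / K) / m := by
      field_simp
    rw [e]
    have h1 := Real.log_le_sub_one_of_pos (show 0 < M * (k / K) / m by positivity)
    calc m * Real.log (M * (k / K) / m) ≤ m * (M * (k / K) / m - 1) :=
          mul_le_mul_of_nonneg_left h1 hm
      _ = M * (k / K) - m := by field_simp

/-- Data processing: a function of `A` has smaller conditional mutual information. -/
theorem condMI_comp_le {Ω A A' B C : Type} [Fintype Ω] [Fintype A] [Fintype A'] [Fintype B]
    [Fintype C] {p : Ω → ℝ} (hp : ∀ ω, 0 ≤ p ω) (f : Ω → A') (g : A' → A) (fB : Ω → B)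
    (fC : Ω → C) :
    condMI p (fun ω => g (f ω)) fB fC ≤ condMI p f fB fC := by
  have e1 : condMI p (fun ω => g (f ω)) fB fC = ∑ a' : A', ∑ b : B, ∑ c : C,
      prE p {ω | f ω = a' ∧ fB ω = b ∧ fC ω = c} *
        Real.log (condPr p {ω | g (f ω) = g a' ∧ fB ω = b} {ω | fC ω = c} /
          (condPr p {ω | g (f ω) = g a'} {ω | fC ω = c} *
            condPr p {ω | fB ω = b} {ω | fC ω = c})) := by
    unfold condMI
    rw [Finset.sum_comm, Finset.sum_comm (s := (Finset.univ : Finset A'))]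
    refine Finset.sum_congr rfl fun b _ => ?_
    rw [Finset.sum_comm, Finset.sum_comm (s := (Finset.univ : Finset A'))]
    refine Finset.sum_congr rfl fun c _ => ?_
    have h1 := sum_prE_mul p (fun ω => g (f ω)) {ω | fB ω = b ∧ fC ω = c}
      (fun a => Real.log (condPr p {ω | g (f ω) = a ∧ fB ω = b} {ω | fC ω = c} /
          (condPr p {ω | g (f ω) = a} {ω | fC ω = c} *
            condPr p {ω | fB ω = b} {ω | fC ω = c})))
    have h2 := sum_prE_mul p f {ω | fB ω = b ∧ fC ω = c}
      (fun a => Real.log (condPr p {ω | g (f ω) = g a ∧ fB ω = b} {ω | fC ω = c} /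
          (condPr p {ω | g (f ω) = g a} {ω | fC ω = c} *
            condPr p {ω | fB ω = b} {ω | fC ω = c})))
    exact h1.trans h2.symm
  rw [e1, ← sub_nonpos]
  unfold condMI
  simp only [← Finset.sum_sub_distrib]
  refine Finset.sum_nonpos fun a' _ => ?_
  rw [Finset.sum_comm]
  refine Finset.sum_nonpos fun c _ => ?_
  have hk : ∑ b : B, prE p {ω | f ω = a' ∧ fB ω = b ∧ fC ω = c} =
      prE p {ω | f ω = a' ∧ fC ω = c} := by
    rw [← sum_prE p fB]
    refine Finset.sum_congr rfl fun b _ => congrArg _ ?_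
    ext ω; simp only [Set.mem_ofPred_eq]; tauto
  have hK : ∑ b : B, prE p {ω | g (f ω) = g a' ∧ fB ω = b ∧ fC ω = c} =
      prE p {ω | g (f ω) = g a' ∧ fC ω = c} := by
    rw [← sum_prE p fB]
    refine Finset.sum_congr rfl fun b _ => congrArg _ ?_
    ext ω; simp only [Set.mem_ofPred_eq]; tauto
  have hfin : ∑ b : B, (prE p {ω | g (f ω) = g a' ∧ fB ω = b ∧ fC ω = c} *
      (prE p {ω | f ω = a' ∧ fC ω = c} / prE p {ω | g (f ω) = g a' ∧ fC ω = c}) -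
      prE p {ω | f ω = a' ∧ fB ω = b ∧ fC ω = c}) ≤ 0 := by
    rw [Finset.sum_sub_distrib, ← Finset.sum_mul, hk, hK]
    set k := prE p {ω | f ω = a' ∧ fC ω = c} with hkd
    set K := prE p {ω | g (f ω) = g a' ∧ fC ω = c} with hKd
    have k0 : 0 ≤ k := prE_nonneg hp _
    have : K * (k / K) = k * (K / K) := by ring
    rw [this]
    have := mul_le_mul_of_nonneg_left (div_self_le_one K) k0
    linarith
  refine le_trans (Finset.sum_le_sum fun b _ => ?_) hfin
  have i1 : ({ω | g (f ω) = g a' ∧ fB ω = b} ∩ {ω | fC ω = c} : Set Ω) =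
      {ω | g (f ω) = g a' ∧ fB ω = b ∧ fC ω = c} := by
    ext ω; simp only [Set.mem_ofPred_eq, Set.mem_inter_iff]; tauto
  have i2 : ({ω | f ω = a' ∧ fB ω = b} ∩ {ω | fC ω = c} : Set Ω) =
      {ω | f ω = a' ∧ fB ω = b ∧ fC ω = c} := by
    ext ω; simp only [Set.mem_ofPred_eq, Set.mem_inter_iff]; tauto
  unfold condPr
  rw [i1, i2]
  refine key_term (prE_nonneg hp _) (prE_mono hp ?_) (prE_mono hp ?_) (prE_mono hp ?_)
    (prE_mono hp ?_) (prE_mono hp ?_)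
  · rintro ω ⟨h1, h2, h3⟩; exact ⟨congrArg g h1, h2, h3⟩
  · rintro ω ⟨h1, h2, h3⟩; exact ⟨h1, h3⟩
  · rintro ω ⟨h1, h2, h3⟩; exact ⟨h1, h3⟩
  · rintro ω ⟨h1, h2, h3⟩; exact ⟨h2, h3⟩
  · rintro ω ⟨h1, h2⟩; exact h2

theorem bound_term {m k pc pbc T : ℝ} (hm : 0 ≤ m) (hmk : m ≤ k)
    (hMb : m ≤ pbc) (hbc : pbc ≤ pc) (hT : pc ≤ T) :
    m * Real.log (m / pc / (k / pc * (pbc / pc))) ≤ T := by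
  rcases hm.eq_or_lt with h | h
  · subst h
    simpa using hMb.trans (hbc.trans hT)
  · have hk : 0 < k := h.trans_le hmk
    have hb : 0 < pbc := h.trans_le hMb
    have hc : 0 < pc := hb.trans_le hbc
    have e : m / pc / (k / pc * (pbc / pc)) = (m * pc) / (k * pbc) := by
      field_simp
    rw [e]
    have h1 := Real.log_le_sub_one_of_pos (show 0 < (m * pc) / (k * pbc) by positivity)
    have h2 : Real.log ((m * pc) / (k * pbc)) ≤ (m * pc) / (k * pbc) := by linarith
    refine le_trans (mul_le_mul_of_nonneg_left h2 hm) (le_trans ?_ hT)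
    rw [← mul_div_assoc, div_le_iff₀ (by positivity)]
    have : m * m ≤ k * pbc := mul_le_mul hmk hMb hm hk.le
    nlinarith

theorem condMI_le {Ω A B C : Type} [Fintype Ω] [Fintype A] [Fintype B] [Fintype C]
    {p : Ω → ℝ} (hp : ∀ ω, 0 ≤ p ω) (hp1 : ∀ ω, p ω ≤ 1) (fA : Ω → A) (fB : Ω → B)
    (fC : Ω → C) :
    condMI p fA fB fC ≤ ∑ _a : A, ∑ _b : B, ∑ _c : C, (Fintype.card Ω : ℝ) := by
  unfold condMI
  refine Finset.sum_le_sum fun a _ => Finset.sum_le_sum fun b _ => Finset.sum_le_sum fun c _ => ?_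
  have i2 : ({ω | fA ω = a ∧ fB ω = b} ∩ {ω | fC ω = c} : Set Ω) =
      {ω | fA ω = a ∧ fB ω = b ∧ fC ω = c} := by
    ext ω; simp only [Set.mem_ofPred_eq, Set.mem_inter_iff]; tauto
  unfold condPr
  rw [i2]
  refine bound_term (prE_nonneg hp _) (prE_mono hp ?_) (prE_mono hp ?_) (prE_mono hp ?_) ?_
  · rintro ω ⟨h1, h2, h3⟩; exact ⟨h1, h3⟩
  · rintro ω ⟨h1, h2, h3⟩; exact ⟨h2, h3⟩
  · rintro ω ⟨h1, h2⟩; exact h2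
  · refine (prE_mono hp (Set.subset_univ _)).trans ?_
    simp only [prE, Set.indicator_univ]
    refine (Finset.sum_le_sum fun ω _ => hp1 ω).trans ?_
    simp

theorem le_one_of_sum {A : Type} [Fintype A] {f : A → ℝ} (h0 : ∀ a, 0 ≤ f a)
    (h1 : ∑ a, f a = 1) (a : A) : f a ≤ 1 := by
  rw [← h1]
  exact Finset.single_le_sum (fun i _ => h0 i) (Finset.mem_univ a)

theorem jointP_nonneg {N u : ℕ} (ch : NCFSC X S Y) (src : Source X S Y N u)
    (ω : Traj X S Y N) : 0 ≤ jointP ch src ω :=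
  mul_nonneg (ch.init_nonneg _) (Finset.prod_nonneg fun i _ =>
    mul_nonneg (src.nonneg _ _ _ _ _) (mul_nonneg (ch.P_nonneg _ _ _) (ch.Q_nonneg _ _)))

theorem jointP_le_one {N u : ℕ} (ch : NCFSC X S Y) (src : Source X S Y N u)
    (ω : Traj X S Y N) : jointP ch src ω ≤ 1 := by
  have hW : ∀ i : Fin N, 0 ≤ ch.W (ω.2.2 i) (ω.2.1 i.succ) (ω.1 i) (ω.2.1 i.castSucc) :=
    fun i => mul_nonneg (ch.P_nonneg _ _ _) (ch.Q_nonneg _ _)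
  refine mul_le_one₀ (le_one_of_sum ch.init_nonneg ch.init_sum _)
    (Finset.prod_nonneg fun i _ => mul_nonneg (src.nonneg _ _ _ _ _) (hW i))
    (Finset.prod_le_one (fun i _ => mul_nonneg (src.nonneg _ _ _ _ _) (hW i)) fun i _ => ?_)
  refine mul_le_one₀ (le_one_of_sum (src.nonneg i _ _ _) (src.sum_one i _ _ _) _) (hW i) ?_
  exact mul_le_one₀
    (le_one_of_sum (f := fun y => ch.P y _ _) (fun y => ch.P_nonneg y _ _) (ch.P_sum _ _) _)
    (ch.Q_nonneg _ _)
    (le_one_of_sum (f := fun s => ch.Q s _) (fun s => ch.Q_nonneg s _) (ch.Q_sum _) _)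

theorem objFull_bdd {N : ℕ} (ch : NCFSC X S Y) (u v : ℕ) :
    BddAbove (Set.range fun src : Source X S Y N u => objFull v ch src) := by
  refine ⟨∑ t : Fin N,
    ∑ _a : ({j : Fin N // (j : ℕ) ≤ (t : ℕ)} → X) ×
        ({j : Fin (N + 1) // (j : ℕ) + v ≤ (t : ℕ)} → S), ∑ _b : Y,
      ∑ _c : {j : Fin N // (j : ℕ) < (t : ℕ)} → Y, (Fintype.card (Traj X S Y N) : ℝ), ?_⟩
  · rintro _ ⟨src, rfl⟩
    exact Finset.sum_le_sum fun t _ =>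
      condMI_le (jointP_nonneg ch src) (jointP_le_one ch src) _ _ _

theorem objFull_succ_le {N u : ℕ} (v : ℕ) (ch : NCFSC X S Y) (src : Source X S Y N u) :
    objFull (v + 1) ch src ≤ objFull v ch src := by
  refine Finset.sum_le_sum fun t _ => ?_
  exact condMI_comp_le (jointP_nonneg ch src)
    (fun ω : Traj X S Y N =>
        ((fun j : {j : Fin N // (j : ℕ) ≤ (t : ℕ)} => ω.1 j.1),
          fun j : {j : Fin (N + 1) // (j : ℕ) + v ≤ (t : ℕ)} => ω.2.1 j.1))
    (fun q => (q.1, fun j : {j : Fin (N + 1) // (j : ℕ) + (v + 1) ≤ (t : ℕ)} =>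
      q.2 ⟨j.1, by have := j.2; omega⟩)) _ _

theorem directedInfo_le {N u : ℕ} (v : ℕ) (ch : NCFSC X S Y) (src : Source X S Y N u) :
    directedInfo ch src ≤ objFull v ch src := by
  refine Finset.sum_le_sum fun t _ => ?_
  exact condMI_comp_le (jointP_nonneg ch src)
    (fun ω : Traj X S Y N =>
        ((fun j : {j : Fin N // (j : ℕ) ≤ (t : ℕ)} => ω.1 j.1),
          fun j : {j : Fin (N + 1) // (j : ℕ) + v ≤ (t : ℕ)} => ω.2.1 j.1))
    (fun q => q.1) _ _

/-- Less delay means more information: `𝒫(u+1,u+1) ⊆ 𝒫(u,u)`. -/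
def Source.relax {N u : ℕ} (src : Source X S Y N (u + 1)) : Source X S Y N u where
  pol := src.pol
  nonneg := src.nonneg
  sum_one := src.sum_one
  causal := fun t x x' s s' y y' hx hs hy =>
    src.causal t x x' s s' y y' hx (fun j hj => hs j (by omega)) (fun j hj => hy j (by omega))

theorem source_nonempty (N u : ℕ) : Nonempty (Source X S Y N u) := by
  classical
  by_cases hX : Nonempty X
  · obtain ⟨a⟩ := hX
    exact ⟨{ pol := fun _ _ _ _ b => if b = a then 1 else 0
             nonneg := fun _ _ _ _ b => by split_ifs <;> norm_num
             sum_one := fun _ _ _ _ => by simp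
             causal := fun _ _ _ _ _ _ _ _ _ _ => rfl }⟩
  · exact ⟨{ pol := fun _ _ _ _ _ => 0
             nonneg := fun _ _ _ _ _ => le_rfl
             sum_one := fun t x _ _ => (hX ⟨x t⟩).elim
             causal := fun _ _ _ _ _ _ _ _ _ _ => rfl }⟩

theorem iSup_relax_le {N : ℕ} (ch : NCFSC X S Y) (u v : ℕ) :
    (⨆ src : Source X S Y N (u + 1), objFull v ch src) ≤
      ⨆ src : Source X S Y N u, objFull v ch src := by
  have := source_nonempty (X := X) (S := S) (Y := Y) N (u + 1)
  exact ciSup_le fun src => le_ciSup (objFull_bdd ch u v) src.relax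

end Helpers

/-- **Proposition 2, finite-horizon form.** With
`Î_N(u,v) := sup_{P ∈ 𝒫(u,u)} Σ_{t=1}^N I(X^t, S_0^{t-v-1}; Y_t | Y^{t-1})`:
(1) `Î_N(u+1,v+1) ≤ Î_N(u+1,v) ≤ Î_N(u,v)` and
    `Î_N(u+1,v+1) ≤ Î_N(u,v+1) ≤ Î_N(u,v)`;
(2) for every source in `𝒫(u,u)` and every `v ≥ 0`,
    `I(X^N → Y^N) ≤ Σ_{t=1}^N I(X^t, S_0^{t-v-1}; Y_t | Y^{t-1})`,
    and the right-hand side is nonincreasing in `v`. -/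
theorem statement2 {X S Y : Type} [Fintype X] [Fintype S] [Fintype Y] {N : ℕ}
    (ch : NCFSC X S Y) (u v : ℕ) :
    ((⨆ src : Source X S Y N (u + 1), objFull (v + 1) ch src) ≤
        ⨆ src : Source X S Y N (u + 1), objFull v ch src) ∧
      ((⨆ src : Source X S Y N (u + 1), objFull v ch src) ≤
        ⨆ src : Source X S Y N u, objFull v ch src) ∧
      ((⨆ src : Source X S Y N (u + 1), objFull (v + 1) ch src) ≤
        ⨆ src : Source X S Y N u, objFull (v + 1) ch src) ∧
      ((⨆ src : Source X S Y N u, objFull (v + 1) ch src) ≤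
        ⨆ src : Source X S Y N u, objFull v ch src) ∧
      (∀ src : Source X S Y N u, directedInfo ch src ≤ objFull v ch src) ∧
      (∀ src : Source X S Y N u, objFull (v + 1) ch src ≤ objFull v ch src) := by
  exact ⟨ciSup_mono (objFull_bdd ch _ _) fun src => objFull_succ_le v ch src,
    iSup_relax_le ch u v, iSup_relax_le ch u (v + 1),
    ciSup_mono (objFull_bdd ch _ _) fun src => objFull_succ_le v ch src,
    fun src => directedInfo_le v ch src, fun src => objFull_succ_le v ch src⟩

end FSCPaper
end
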